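/- arXiv:1312.7233 — 6 statements merged into one kernel-verified Lean document; each statement's English description precedes it below -/
import Mathlib

section
/- Let T be a tree with at least four vertices and let v be a leaf of T. Then the number of subtrees of T that contain v is strictly less than half of the total number of subtrees of T. -/
open SimpleGraph Finset BigOperators Filter

attribute [local instance] Classical.propDecidable

/-- A finset of vertices induces a subtree of `G`: it is nonempty and its induced
subgraph is connected. -/
def SimpleGraph.IsSubtree {V : Type*} (G : SimpleGraph V) (s : Finset V) : Prop :=
  s.Nonempty ∧ (G.induce (s : Set V)).Connected

/-- The collection of all subtrees of `G` (as finsets of vertices). -/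
noncomputable def subtreeFinset {V : Type*} [Fintype V] (G : SimpleGraph V) :
    Finset (Finset V) :=
  Finset.univ.filter G.IsSubtree

namespace SimpleGraph

variable {V : Type*} {G : SimpleGraph V} {s : Finset V} {u v w : V}

lemma isSubtree_singleton (w : V) : G.IsSubtree {w} := by
  refine ⟨singleton_nonempty w, ?_⟩
  rw [coe_singleton]
  exact ⟨fun a b => by rw [Subsingleton.elim a b]⟩

lemma IsSubtree.exists_adj (hs : G.IsSubtree s) (hv : v ∈ s) (hne : s ≠ {v}) :
    ∃ w ∈ s, G.Adj v w := by
  obtain ⟨x, hx, hxv⟩ : ∃ x ∈ s, x ≠ v := by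
    by_contra! h
    exact hne (eq_singleton_iff_unique_mem.2 ⟨hv, h⟩)
  have : Nontrivial (s : Set V) := ⟨⟨⟨x, hx⟩, ⟨v, hv⟩, by simpa using hxv⟩⟩
  obtain ⟨w, hw⟩ := hs.2.preconnected.exists_adj_of_nontrivial ⟨v, hv⟩
  exact ⟨w, w.2, hw⟩

/-- Removing a leaf from a subtree with another vertex leaves a subtree. -/
lemma IsSubtree.erase_leaf (hs : G.IsSubtree s) (hv : v ∈ s) (hne : s ≠ {v})
    (hu : ∀ w, G.Adj v w ↔ w = u) : u ∈ s.erase v ∧ G.IsSubtree (s.erase v) := by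
  obtain ⟨w, hws, hvw⟩ := hs.exists_adj hv hne
  obtain rfl := (hu w).1 hvw
  have hmem : w ∈ s.erase v := mem_erase.2 ⟨hvw.ne', hws⟩
  refine ⟨hmem, ⟨w, hmem⟩, ?_⟩
  have hdeg : (G.induce (s : Set V)).degree ⟨v, hv⟩ = 1 := by
    rw [degree_eq_one_iff_existsUnique_adj]
    exact ⟨⟨w, hws⟩, hvw, fun y hy => Subtype.ext ((hu y).1 hy)⟩
  have hconn := hs.2.induce_compl_singleton_of_degree_eq_one hdeg
  let f : (G.induce (s : Set V)).induce {⟨v, hv⟩}ᶜ →g G.induce (s.erase v : Set V) :=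
    { toFun := fun x => ⟨x.1.1,
        mem_coe.2 (mem_erase.2 ⟨fun h => x.2 (Subtype.ext h), x.1.2⟩)⟩
      map_rel' := fun h => h }
  refine hconn.map f fun y => ?_
  have hy := mem_erase.1 (mem_coe.1 y.2)
  exact ⟨⟨⟨y, hy.2⟩, by simpa [Subtype.ext_iff] using hy.1⟩, rfl⟩

end SimpleGraph

/-- If `v` is a leaf of a tree `T` with at least four vertices, then strictly less
than half of the subtrees of `T` contain `v`. -/
theorem leaf_in_less_than_half_subtrees {V : Type*} [Fintype V] (G : SimpleGraph V)
    (hT : G.IsTree) (hn : 4 ≤ Fintype.card V) (v : V) (hv : G.degree v = 1) :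
    2 * ((subtreeFinset G).filter (fun s => v ∈ s)).card < (subtreeFinset G).card := by
  obtain ⟨u, huv, hu⟩ := degree_eq_one_iff_existsUnique_adj.1 hv
  have hu' : ∀ w, G.Adj v w ↔ w = u := fun w => ⟨hu w, fun h => h ▸ huv⟩
  set A := (subtreeFinset G).filter (fun s => v ∈ s) with hA
  set B := (subtreeFinset G).filter (fun s => v ∉ s) with hB
  have hsum : A.card + B.card = (subtreeFinset G).card := card_filter_add_card_filter_not _
  have hsplit : (B.filter (fun s => u ∈ s)).card + (B.filter (fun s => u ∉ s)).card = B.card :=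
    card_filter_add_card_filter_not _
  have hA_le : (A.erase {v}).card ≤ (B.filter (fun s => u ∈ s)).card := by
    refine card_le_card_of_injOn (fun s => s.erase v) (fun s hs => ?_) fun s hs t ht hst => ?_
    · simp only [hA, coe_erase, Set.mem_sdiff, mem_coe, mem_filter, subtreeFinset, mem_univ,
        true_and, Set.mem_singleton_iff] at hs
      obtain ⟨h1, h2⟩ := hs.1.1.erase_leaf hs.1.2 hs.2 hu'
      simp only [hB, mem_coe, mem_filter, subtreeFinset, mem_univ, true_and]
      exact ⟨⟨h2, notMem_erase v s⟩, h1⟩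
    · have hvs : v ∈ s := (mem_filter.1 (mem_of_mem_erase (mem_coe.1 hs))).2
      have hvt : v ∈ t := (mem_filter.1 (mem_of_mem_erase (mem_coe.1 ht))).2
      rw [← insert_erase hvs, ← insert_erase hvt]
      exact congrArg (insert v) hst
  have hsing : ((univ : Finset V) \ {u, v}).card ≤ (B.filter (fun s => u ∉ s)).card := by
    refine card_le_card_of_injOn (fun w => {w}) (fun w hw => ?_)
      (Finset.singleton_injective.injOn)
    simp only [coe_sdiff, Set.mem_sdiff, mem_coe, mem_insert, mem_singleton, not_or] at hw
    simp only [hB, mem_coe, mem_filter, subtreeFinset, mem_univ, true_and, mem_singleton]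
    exact ⟨⟨isSubtree_singleton w, Ne.symm hw.2.2⟩, Ne.symm hw.2.1⟩
  have hcard := le_card_sdiff ({u, v} : Finset V) univ
  have htwo : ({u, v} : Finset V).card ≤ 2 := card_le_two
  have herase := pred_card_le_card_erase (s := A) (a := {v})
  rw [card_univ] at hcard
  omega
end

section
/- If T is a tree in 𝒯₃ with n vertices, then μ(T) < (3n − 2)/4; in particular D(T) < 3/4. -/
open SimpleGraph Finset BigOperators Filter

attribute [local instance] Classical.propDecidable

/-- `μ(G)`: the average order (number of vertices) of a subtree of `G`. -/
noncomputable def mu {V : Type*} [Fintype V] (G : SimpleGraph V) : ℚ :=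
  (∑ s ∈ subtreeFinset G, (s.card : ℚ)) / ((subtreeFinset G).card : ℚ)

/-- The number of leaves (vertices of degree one) of `G`. -/
noncomputable def numLeaves {V : Type*} [Fintype V] (G : SimpleGraph V) : ℕ :=
  (Finset.univ.filter (fun v => G.degree v = 1)).card

/-- `G` is in the class 𝒯₃: a tree with at least one internal vertex (a vertex of
degree at least 2) in which every internal vertex has degree at least 3. -/
noncomputable def InT3 {V : Type*} [Fintype V] (G : SimpleGraph V) : Prop :=
  G.IsTree ∧ (∃ v, 2 ≤ G.degree v) ∧ ∀ v, 2 ≤ G.degree v → 3 ≤ G.degree v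

section SubtreeAverage

variable {V : Type*} {G : SimpleGraph V}

lemma mem_subtreeFinset [Fintype V] {s : Finset V} :
    s ∈ subtreeFinset G ↔ G.IsSubtree s := by
  simp [subtreeFinset]

lemma SimpleGraph.isSubtree_singleton_s2 (v : V) : G.IsSubtree {v} := by
  refine ⟨singleton_nonempty v, ?_⟩
  rw [coe_singleton]
  exact ⟨fun a b ↦ Subsingleton.elim a b ▸ Reachable.rfl⟩

lemma SimpleGraph.IsSubtree.exists_adj_s2 {s : Finset V} (hs : G.IsSubtree s) {v : V}
    (hv : v ∈ s) (hne : s ≠ {v}) : ∃ w ∈ s, G.Adj v w := by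
  obtain ⟨x, hx, hxv⟩ : ∃ x ∈ s, x ≠ v := by
    by_contra! hall
    exact hne (eq_singleton_iff_unique_mem.mpr ⟨hv, hall⟩)
  have : Nontrivial ↑(s : Set V) := ⟨⟨x, hx⟩, ⟨v, hv⟩, by simpa using hxv⟩
  obtain ⟨w, hw⟩ := hs.2.preconnected.exists_adj_of_nontrivial ⟨v, hv⟩
  exact ⟨w, w.2, hw⟩

lemma SimpleGraph.IsSubtree.erase_leaf_s2 {s : Finset V} (hs : G.IsSubtree s) {u v : V}
    (huv : ∀ w, G.Adj v w ↔ w = u) (hv : v ∈ s) (hu : u ∈ s) :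
    G.IsSubtree (s.erase v) := by
  have hadj : G.Adj v u := (huv u).mpr rfl
  refine ⟨⟨u, mem_erase.mpr ⟨hadj.ne', hu⟩⟩, ?_⟩
  have hdeg : (G.induce (s : Set V)).degree ⟨v, hv⟩ = 1 := by
    rw [degree_eq_one_iff_existsUnique_adj]
    refine ⟨⟨u, hu⟩, hadj, fun w hw ↦ Subtype.ext ((huv w).mp hw)⟩
  have hconn := hs.2.induce_compl_singleton_of_degree_eq_one hdeg
  let f : (G.induce (s : Set V)).induce {(⟨v, hv⟩ : ↑(s : Set V))}ᶜ →g
      G.induce (s.erase v : Set V) :=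
    { toFun := fun x ↦ ⟨x.1.1, by
        have hx := x.2
        simp only [Set.mem_compl_iff, Set.mem_singleton_iff] at hx
        exact mem_coe.mpr (mem_erase.mpr ⟨fun h ↦ hx (Subtype.ext h), x.1.2⟩)⟩
      map_rel' := fun h ↦ h }
  refine hconn.map f fun y ↦ ?_
  have hy := mem_erase.mp (mem_coe.mp y.2)
  exact ⟨⟨⟨y.1, hy.2⟩, fun h ↦ hy.1 (congrArg Subtype.val h)⟩, rfl⟩

/-- In a graph with at least four vertices, fewer than half of the subtrees contain a given
leaf. -/
lemma two_mul_card_filter_leaf_lt [Fintype V] (hV : 4 ≤ Fintype.card V) {v : V}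
    (hv : G.degree v = 1) :
    2 * #{s ∈ subtreeFinset G | v ∈ s} < #(subtreeFinset G) := by
  obtain ⟨u, hadj, huniq⟩ := degree_eq_one_iff_existsUnique_adj.mp hv
  have huv : ∀ w, G.Adj v w ↔ w = u := fun w ↦ ⟨huniq w, fun h ↦ h ▸ hadj⟩
  set A := {s ∈ subtreeFinset G | v ∈ s}
  set B := {s ∈ subtreeFinset G | v ∉ s}
  set C := {s ∈ B | u ∈ s}
  set D := {s ∈ B | u ∉ s}
  have hAB : #A + #B = #(subtreeFinset G) := card_filter_add_card_filter_not _
  have hCD : #C + #D = #B := card_filter_add_card_filter_not _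
  have hAC : #(A.erase {v}) ≤ #C := by
    refine card_le_card_of_injOn (fun s ↦ s.erase v) ?_ ?_
    · intro s hs
      obtain ⟨hne, hsA⟩ := mem_erase.mp (mem_coe.mp hs)
      obtain ⟨hs, hvs⟩ := mem_filter.mp hsA
      rw [mem_subtreeFinset] at hs
      obtain ⟨w, hw, hvw⟩ := hs.exists_adj_s2 hvs hne
      obtain rfl := (huv w).mp hvw
      refine mem_coe.mpr (mem_filter.mpr ⟨mem_filter.mpr ⟨?_, notMem_erase v s⟩, ?_⟩)
      · exact mem_subtreeFinset.mpr (hs.erase_leaf_s2 huv hvs hw)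
      · exact mem_erase.mpr ⟨hadj.ne', hw⟩
    · intro s hs t ht hst
      have hvs := (mem_filter.mp (mem_erase.mp (mem_coe.mp hs)).2).2
      have hvt := (mem_filter.mp (mem_erase.mp (mem_coe.mp ht)).2).2
      rw [← insert_erase hvs, ← insert_erase hvt]
      exact congrArg (insert v) hst
  have hA : #A ≤ #(A.erase {v}) + 1 := by
    have := pred_card_le_card_erase (s := A) (a := {v})
    lia
  have hD : 2 ≤ #D := by
    have hrest : 2 ≤ #(({u, v} : Finset V)ᶜ) := by
      rw [card_compl]
      have : #({u, v} : Finset V) ≤ 2 := card_le_two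
      lia
    refine hrest.trans (card_le_card_of_injOn (fun w ↦ {w}) ?_ ?_)
    · intro w hw
      simp only [coe_compl, Set.mem_compl_iff, mem_coe, mem_insert, mem_singleton,
        not_or] at hw
      refine mem_coe.mpr (mem_filter.mpr ⟨mem_filter.mpr ⟨?_, ?_⟩, ?_⟩)
      · exact mem_subtreeFinset.mpr (isSubtree_singleton_s2 w)
      · simpa using Ne.symm hw.2
      · simpa using Ne.symm hw.1
    · exact singleton_injective.injOn
  lia

/-- More than half of the vertices of a tree in `𝒯₃` are leaves. -/
lemma InT3.card_add_two_le [Fintype V] (h : InT3 G) :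
    Fintype.card V + 2 ≤ 2 * numLeaves G := by
  obtain ⟨htree, ⟨x, hx⟩, hdeg⟩ := h
  have hnontriv : Nontrivial V := by
    obtain ⟨w, hw⟩ := (G.degree_pos_iff_exists_adj x).mp (by lia)
    exact ⟨x, w, hw.ne⟩
  have hbound : ∀ v, 3 ≤ G.degree v + 2 * (if G.degree v = 1 then 1 else 0) := by
    intro v
    have hpos := htree.connected.preconnected.degree_pos_of_nontrivial v
    have := hdeg v
    split_ifs <;> lia
  have hsum := sum_le_sum (s := (univ : Finset V)) fun v _ ↦ hbound v
  rw [sum_add_distrib, ← mul_sum, ← card_filter, sum_degrees_eq_twice_card_edges] at hsum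
  simp only [sum_const, card_univ, smul_eq_mul] at hsum
  have hedges := htree.card_edgeFinset
  unfold numLeaves
  lia

lemma InT3.four_le_card [Fintype V] (h : InT3 G) : 4 ≤ Fintype.card V := by
  obtain ⟨-, ⟨x, hx⟩, hdeg⟩ := h
  have := hdeg x hx
  have := G.degree_lt_card_verts x
  lia

lemma InT3.two_mul_sum_card_lt [Fintype V] (h : InT3 G) :
    2 * ∑ s ∈ subtreeFinset G, #s + numLeaves G * #(subtreeFinset G) <
      2 * Fintype.card V * #(subtreeFinset G) := by
  have hcount : ∑ s ∈ subtreeFinset G, #s = ∑ v : V, #{s ∈ subtreeFinset G | v ∈ s} := by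
    simp_rw [card_filter]
    rw [sum_comm]
    simp
  have hle : ∀ v : V, 2 * #{s ∈ subtreeFinset G | v ∈ s} +
      (if G.degree v = 1 then 1 else 0) * #(subtreeFinset G) ≤ 2 * #(subtreeFinset G) := by
    intro v
    split_ifs with hv
    · have := two_mul_card_filter_leaf_lt h.four_le_card hv
      lia
    · have := card_filter_le (subtreeFinset G) (v ∈ ·)
      lia
  obtain ⟨v, hv⟩ : ∃ v, G.degree v = 1 := by
    have hpos : 0 < numLeaves G := by have := h.card_add_two_le; lia
    obtain ⟨v, hv⟩ := card_pos.mp hpos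
    exact ⟨v, (mem_filter.mp hv).2⟩
  have hlt := two_mul_card_filter_leaf_lt h.four_le_card hv
  have hsum := sum_lt_sum (s := (univ : Finset V)) (fun w _ ↦ hle w)
    ⟨v, mem_univ v, by rw [if_pos hv]; lia⟩
  rw [sum_add_distrib, ← mul_sum, ← sum_mul, ← card_filter, ← hcount, sum_const, card_univ,
    smul_eq_mul] at hsum
  unfold numLeaves
  lia

end SubtreeAverage

/-- If `T ∈ 𝒯₃` has `n` vertices then `μ(T) < (3n - 2)/4`; in particular the
average subtree density `D(T) = μ(T)/n` is less than `3/4`. -/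
theorem mu_lt_of_inT3 {V : Type*} [Fintype V] (G : SimpleGraph V) (h : InT3 G) :
    mu G < (3 * (Fintype.card V : ℚ) - 2) / 4 ∧
      mu G / (Fintype.card V : ℚ) < 3 / 4 := by
  have hlt := h.two_mul_sum_card_lt
  have hleaves := h.card_add_two_le
  have hcard := h.four_le_card
  have hpos : 0 < #(subtreeFinset G) := by
    rw [Nat.pos_iff_ne_zero]
    intro h0
    simp [h0] at hlt
  have hlt' : (2 * ∑ s ∈ subtreeFinset G, (#s : ℚ)) + numLeaves G * #(subtreeFinset G) <
      2 * Fintype.card V * #(subtreeFinset G) := by exact_mod_cast hlt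
  have hleaves' : (Fintype.card V + 2 : ℚ) ≤ 2 * numLeaves G := by exact_mod_cast hleaves
  have hpos' : (0 : ℚ) < #(subtreeFinset G) := by exact_mod_cast hpos
  have hcard' : (4 : ℚ) ≤ Fintype.card V := by exact_mod_cast hcard
  have hmu : mu G < (3 * (Fintype.card V : ℚ) - 2) / 4 := by
    rw [mu, div_lt_iff₀ hpos']
    nlinarith [mul_le_mul_of_nonneg_right hleaves' hpos'.le]
  refine ⟨hmu, ?_⟩
  rw [div_lt_iff₀ (by linarith)]
  linarith
end

section
/- Let T be a tree, let v be a twig of T, and let a ≥ 2 be the number of leaves adjacent to v. Then the number of sets in 𝒮'(T) containing v is at most (2^a/(2^a + 1))·|𝒮'(T)|, and for each leaf u adjacent to v, the number of sets in 𝒮'(T) containing u is at most (2^{a−1}/(2^a + 1))·|𝒮'(T)|. -/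
open SimpleGraph Finset BigOperators Filter

attribute [local instance] Classical.propDecidable

/-- `𝒮'(G)`: the collection obtained from the collection of subtrees of `G` by
adding the empty set and removing the singleton `{v}` for every leaf `v`. -/
noncomputable def subtreeFinset' {V : Type*} [Fintype V] (G : SimpleGraph V) :
    Finset (Finset V) :=
  insert ∅ ((subtreeFinset G).filter (fun s => ¬ ∃ v, G.degree v = 1 ∧ s = {v}))

/-- `μ'(G)`: the average cardinality of a member of `𝒮'(G)`. -/
noncomputable def mu' {V : Type*} [Fintype V] (G : SimpleGraph V) : ℚ :=
  (∑ s ∈ subtreeFinset' G, (s.card : ℚ)) / ((subtreeFinset' G).card : ℚ)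

/-- `v` is a twig of `G`: it has degree at least 2 and at least `deg(v) - 1` of its
neighbours are leaves. -/
noncomputable def IsTwig {V : Type*} [Fintype V] (G : SimpleGraph V) (v : V) : Prop :=
  2 ≤ G.degree v ∧
    G.degree v - 1 ≤ ((G.neighborFinset v).filter (fun u => G.degree u = 1)).card

/-- The number of twigs of `G`. -/
noncomputable def numTwigs {V : Type*} [Fintype V] (G : SimpleGraph V) : ℕ :=
  (Finset.univ.filter (fun v => IsTwig G v)).card

namespace SimpleGraph.IsSubtree

variable {V : Type*} {G : SimpleGraph V} {s t : Finset V} {x y : V}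

/-- Deleting vertices with at most one neighbour in a subtree leaves a subtree. -/
lemma of_subset (hs : G.IsSubtree s) (hts : t ⊆ s) (ht : t.Nonempty)
    (h : ∀ x ∈ s, x ∉ t → ∀ y ∈ s, ∀ z ∈ s, G.Adj x y → G.Adj x z → y = z) :
    G.IsSubtree t := by
  refine ⟨ht, ?_⟩
  have key := hs.2.preconnected.induce_of_degree_eq_one
    (s := {x : (s : Set V) | (x : V) ∈ t}) (by
      rintro ⟨x, hx⟩ hxt ⟨y, hy⟩ hxy ⟨z, hz⟩ hxz
      exact Subtype.ext (h x hx hxt y hy z hz hxy hxz))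
  have : Nonempty (t : Set V) := ht.to_subtype
  let f : (G.induce (s : Set V)).induce {x : (s : Set V) | (x : V) ∈ t} →g
      G.induce (t : Set V) := ⟨fun x => ⟨x.1.1, x.2⟩, fun hab => hab⟩
  exact ⟨key.map f fun x => ⟨⟨⟨x.1, hts x.2⟩, x.2⟩, rfl⟩⟩

lemma exists_adj_s8 (hs : G.IsSubtree s) (hx : x ∈ s) (hy : y ∈ s) (hxy : x ≠ y) :
    ∃ z ∈ s, G.Adj x z := by
  have : Nontrivial (s : Set V) := ⟨⟨x, hx⟩, ⟨y, hy⟩, by simpa using hxy⟩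
  obtain ⟨z, hz⟩ := hs.2.preconnected.exists_adj_of_nontrivial ⟨x, hx⟩
  exact ⟨z.1, z.2, hz⟩

end SimpleGraph.IsSubtree

section Twig

variable {V : Type*} [Fintype V] {G : SimpleGraph V} {s : Finset V} {u v w : V}

lemma mem_subtreeFinset' :
    s ∈ subtreeFinset' G ↔ s = ∅ ∨ G.IsSubtree s ∧ ∀ v, G.degree v = 1 → s ≠ {v} := by
  simp [subtreeFinset', subtreeFinset]

lemma SimpleGraph.eq_of_adj_of_degree_eq_one {x y z : V} (hx : G.degree x = 1)
    (hy : G.Adj x y) (hz : G.Adj x z) : y = z :=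
  (degree_eq_one_iff_existsUnique_adj.1 hx).unique hy hz

/-- The set of leaves of `G` adjacent to `v`. -/
noncomputable def adjacentLeaves (G : SimpleGraph V) (v : V) : Finset V :=
  (G.neighborFinset v).filter (fun u => G.degree u = 1)

lemma mem_adjacentLeaves : u ∈ adjacentLeaves G v ↔ G.Adj v u ∧ G.degree u = 1 := by
  simp [adjacentLeaves]

lemma IsTwig.eq_of_adj (hv : IsTwig G v) (hu : G.Adj v u) (hw : G.Adj v w)
    (hul : u ∉ adjacentLeaves G v) (hwl : w ∉ adjacentLeaves G v) : u = w := by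
  have hsub : adjacentLeaves G v ⊆ G.neighborFinset v := filter_subset _ _
  have hcard := card_sdiff_add_card_eq_card hsub
  have hle : G.degree v - 1 ≤ (adjacentLeaves G v).card := hv.2
  rw [card_neighborFinset_eq_degree] at hcard
  have hone : (G.neighborFinset v \ adjacentLeaves G v).card ≤ 1 := by omega
  exact card_le_one.1 hone u (by simp [hu, hul]) w (by simp [hw, hwl])

lemma mem_of_mem_of_adjacent_leaf (hs : s ∈ subtreeFinset' G) (hvu : G.Adj v u)
    (hu : G.degree u = 1) (hus : u ∈ s) : v ∈ s := by
  obtain rfl | ⟨hs, hne⟩ := mem_subtreeFinset'.1 hs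
  · simp at hus
  obtain ⟨y, hy, hyu⟩ : ∃ y ∈ s, y ≠ u := by
    by_contra! h
    exact hne u hu (eq_singleton_iff_unique_mem.2 ⟨hus, h⟩)
  obtain ⟨z, hz, huz⟩ := hs.exists_adj_s8 hus hy hyu.symm
  rwa [eq_of_adj_of_degree_eq_one hu hvu.symm huz]

lemma IsTwig.erase_sdiff_mem (hv : IsTwig G v) (hs : s ∈ subtreeFinset' G) (hvs : v ∈ s) :
    (s \ adjacentLeaves G v).erase v ∈ subtreeFinset' G := by
  obtain rfl | ⟨hs, -⟩ := mem_subtreeFinset'.1 hs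
  · simp at hvs
  rw [mem_subtreeFinset']
  refine (eq_empty_or_nonempty _).imp_right fun hne => ?_
  have hvL : v ∉ adjacentLeaves G v := fun h => G.irrefl (mem_adjacentLeaves.1 h).1
  have hL : G.IsSubtree (s \ adjacentLeaves G v) := by
    refine hs.of_subset sdiff_subset ⟨v, by simp [hvs, hvL]⟩ fun x hx hxL y _ z _ hy hz => ?_
    have hx' : x ∈ adjacentLeaves G v := by simpa [hx] using hxL
    exact eq_of_adj_of_degree_eq_one (mem_adjacentLeaves.1 hx').2 hy hz
  refine ⟨hL.of_subset (erase_subset _ _) hne fun x hx hxv y hy z hz hxy hxz => ?_, ?_⟩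
  · obtain rfl : x = v := by
      by_contra h
      exact hxv (mem_erase.2 ⟨h, hx⟩)
    exact hv.eq_of_adj hxy hxz (mem_sdiff.1 hy).2 (mem_sdiff.1 hz).2
  · intro x hx hsx
    have hxe : x ∈ (s \ adjacentLeaves G v).erase v := by simp [hsx]
    obtain ⟨hxv, hxL⟩ := mem_erase.1 hxe
    obtain ⟨z, hz, hxz⟩ := hL.exists_adj_s8 hxL (mem_sdiff.2 ⟨hvs, hvL⟩) hxv
    have hzv : z = v := by
      by_contra h
      have hze := mem_erase.2 ⟨h, hz⟩
      rw [hsx, mem_singleton] at hze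
      exact G.irrefl (hze ▸ hxz)
    subst hzv
    exact (mem_sdiff.1 hxL).2 (mem_adjacentLeaves.2 ⟨hxz.symm, hx⟩)

lemma IsTwig.card_filter_mem_le (hv : IsTwig G v) :
    ((subtreeFinset' G).filter (fun s => v ∈ s)).card ≤
      2 ^ (adjacentLeaves G v).card * ((subtreeFinset' G).filter (fun s => v ∉ s)).card := by
  rw [← card_powerset, ← card_product]
  refine card_le_card_of_injOn
    (fun s => (s ∩ adjacentLeaves G v, (s \ adjacentLeaves G v).erase v)) ?_ ?_
  · intro s hs
    obtain ⟨hs, hvs⟩ := mem_filter.1 (mem_coe.1 hs)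
    simp only [coe_product, Set.mem_prod, mem_coe, mem_powerset, mem_filter]
    exact ⟨inter_subset_right, hv.erase_sdiff_mem hs hvs, notMem_erase _ _⟩
  · intro s hs t ht hst
    have hvs := (mem_filter.1 (mem_coe.1 hs)).2
    have hvt := (mem_filter.1 (mem_coe.1 ht)).2
    obtain ⟨h₁, h₂⟩ := Prod.ext_iff.1 hst
    ext x
    have h₁x := Finset.ext_iff.1 h₁ x
    have h₂x := Finset.ext_iff.1 h₂ x
    simp only [mem_inter, mem_erase, Finset.mem_sdiff] at h₁x h₂x
    by_cases hx : x = v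
    · simp [hx, hvs, hvt]
    · tauto

lemma IsTwig.erase_leaf_mem (hv : IsTwig G v) (hs : s ∈ subtreeFinset' G) (hvu : G.Adj v u)
    (hu : G.degree u = 1) (hvs : v ∈ s) : s.erase u ∈ subtreeFinset' G := by
  obtain rfl | ⟨hs, -⟩ := mem_subtreeFinset'.1 hs
  · simp at hvs
  have hve : v ∈ s.erase u := mem_erase.2 ⟨hvu.ne, hvs⟩
  refine mem_subtreeFinset'.2 (.inr ⟨?_, ?_⟩)
  · refine hs.of_subset (erase_subset _ _) ⟨v, hve⟩ fun x hx hxu y _ z _ hy hz => ?_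
    obtain rfl : x = u := by
      by_contra h
      exact hxu (mem_erase.2 ⟨h, hx⟩)
    exact eq_of_adj_of_degree_eq_one hu hy hz
  · intro x hx hsx
    rw [hsx, mem_singleton] at hve
    have := hv.1
    rw [hve] at this
    omega

lemma IsTwig.two_mul_card_filter_leaf_mem_le (hv : IsTwig G v) (hvu : G.Adj v u)
    (hu : G.degree u = 1) :
    2 * ((subtreeFinset' G).filter (fun s => u ∈ s)).card ≤
      ((subtreeFinset' G).filter (fun s => v ∈ s)).card := by
  have hfilter : ((subtreeFinset' G).filter (fun s => v ∈ s)).filter (fun s => u ∈ s) =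
      (subtreeFinset' G).filter (fun s => u ∈ s) := by
    ext s
    simp only [mem_filter]
    exact ⟨fun h => ⟨h.1.1, h.2⟩,
      fun h => ⟨⟨h.1, mem_of_mem_of_adjacent_leaf h.1 hvu hu h.2⟩, h.2⟩⟩
  have hle : ((subtreeFinset' G).filter (fun s => u ∈ s)).card ≤
      (((subtreeFinset' G).filter (fun s => v ∈ s)).filter (fun s => u ∉ s)).card := by
    refine card_le_card_of_injOn (fun s => s.erase u) ?_ ?_
    · intro s hs
      obtain ⟨hs, hus⟩ := mem_filter.1 (mem_coe.1 hs)
      have hvs := mem_of_mem_of_adjacent_leaf hs hvu hu hus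
      simp only [mem_coe, mem_filter]
      exact ⟨⟨hv.erase_leaf_mem hs hvu hu hvs, mem_erase.2 ⟨hvu.ne, hvs⟩⟩, notMem_erase _ _⟩
    · exact (erase_injOn' u).mono fun s hs => (mem_filter.1 (mem_coe.1 hs)).2
  have hadd := card_filter_add_card_filter_not
    (s := (subtreeFinset' G).filter (fun s => v ∈ s)) (fun s => u ∈ s)
  rw [hfilter] at hadd
  omega

end Twig

/-- Let `v` be a twig of a tree `T` with `a ≥ 2` adjacent leaves. Then the number
of sets in `𝒮'(T)` containing `v` is at most `2^a/(2^a+1)` of `|𝒮'(T)|`, and for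
each leaf `u` adjacent to `v` the number of sets in `𝒮'(T)` containing `u` is at
most `2^(a-1)/(2^a+1)` of `|𝒮'(T)|`. -/
theorem twig_subtree_proportions {V : Type*} [Fintype V] (G : SimpleGraph V)
    (hT : G.IsTree) (v : V) (hv : IsTwig G v) (a : ℕ)
    (ha : a = ((G.neighborFinset v).filter (fun u => G.degree u = 1)).card)
    (ha2 : 2 ≤ a) :
    ((((subtreeFinset' G).filter (fun s => v ∈ s)).card : ℚ) ≤
        2 ^ a / (2 ^ a + 1) * ((subtreeFinset' G).card : ℚ)) ∧
      ∀ u, G.Adj v u → G.degree u = 1 →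
        ((((subtreeFinset' G).filter (fun s => u ∈ s)).card : ℚ) ≤
          2 ^ (a - 1) / (2 ^ a + 1) * ((subtreeFinset' G).card : ℚ)) := by
  have hmem : (((subtreeFinset' G).filter (fun s => v ∈ s)).card : ℚ) ≤
      2 ^ a * (((subtreeFinset' G).filter (fun s => v ∉ s)).card : ℚ) := by
    rw [ha]
    exact_mod_cast hv.card_filter_mem_le
  have hadd : (((subtreeFinset' G).filter (fun s => v ∈ s)).card : ℚ) +
      (((subtreeFinset' G).filter (fun s => v ∉ s)).card : ℚ) = (subtreeFinset' G).card := by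
    exact_mod_cast card_filter_add_card_filter_not (s := subtreeFinset' G) (fun s => v ∈ s)
  have hpos : (0 : ℚ) < 2 ^ a + 1 := by positivity
  have hv' : (((subtreeFinset' G).filter (fun s => v ∈ s)).card : ℚ) ≤
      2 ^ a / (2 ^ a + 1) * ((subtreeFinset' G).card : ℚ) := by
    rw [div_mul_eq_mul_div, le_div_iff₀ hpos, ← hadd]
    linarith
  refine ⟨hv', fun u hvu hu => ?_⟩
  have htwo : 2 * (((subtreeFinset' G).filter (fun s => u ∈ s)).card : ℚ) ≤
      (((subtreeFinset' G).filter (fun s => v ∈ s)).card : ℚ) := by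
    exact_mod_cast hv.two_mul_card_filter_leaf_mem_le hvu hu
  have hpow : (2 : ℚ) ^ a = 2 * 2 ^ (a - 1) := by
    rw [← pow_succ', Nat.sub_add_cancel (by omega)]
  have hhalf : (2 : ℚ) ^ a / (2 ^ a + 1) * ((subtreeFinset' G).card : ℚ) =
      2 * (2 ^ (a - 1) / (2 ^ a + 1) * ((subtreeFinset' G).card : ℚ)) := by
    rw [hpow]
    ring
  linarith
end

section
/- Let T be a tree and v a vertex of T with neighbours v₁, …, v_d, and for each i let T_i be the connected component of T − v containing v_i. Then λ(T,v) = 1 + Σ_{i=1}^{d} λ(T_i,v_i)·α(T_i,v_i)/(α(T_i,v_i) + 1). -/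
open SimpleGraph Finset BigOperators Filter

attribute [local instance] Classical.propDecidable

/-- `λ(G,v)`: the average order of the subtrees of `G` containing the vertex `v`. -/
noncomputable def lambdaV {V : Type*} [Fintype V] (G : SimpleGraph V) (v : V) : ℚ :=
  (∑ s ∈ (subtreeFinset G).filter (fun s => v ∈ s), (s.card : ℚ)) /
    (((subtreeFinset G).filter (fun s => v ∈ s)).card : ℚ)

/-- The number of subtrees of `G` containing `u` and avoiding `v`. For a tree `G`,
this equals `α(T_u, u)` where `T_u` is the component of `G - v` containing a
neighbour `u` of `v`, since a connected vertex set containing `u` and avoiding `v`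
lies entirely inside that component. -/
noncomputable def alphaAvoid {V : Type*} [Fintype V] (G : SimpleGraph V) (u v : V) : ℕ :=
  ((subtreeFinset G).filter (fun s => u ∈ s ∧ v ∉ s)).card

/-- The average order of the subtrees of `G` containing `u` and avoiding `v`; for a
tree `G` and `u` a neighbour of `v` this equals `λ(T_u, u)` where `T_u` is the
component of `G - v` containing `u`. -/
noncomputable def lambdaAvoid {V : Type*} [Fintype V] (G : SimpleGraph V) (u v : V) : ℚ :=
  (∑ s ∈ (subtreeFinset G).filter (fun s => u ∈ s ∧ v ∉ s), (s.card : ℚ)) /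
    (alphaAvoid G u v : ℚ)

/-- The average over a product of finsets of a function of a single coordinate is the average of
that function over the corresponding factor. -/
theorem Fintype.sum_piFinset_eval_div_card {ι α : Type*} [Fintype ι] [DecidableEq ι]
    (t : ι → Finset α) (ht : ∀ i, (t i).Nonempty) (i : ι) (f : α → ℚ) :
    (∑ p ∈ Fintype.piFinset t, f (p i)) / ((Fintype.piFinset t).card : ℚ) =
      (∑ x ∈ t i, f x) / ((t i).card : ℚ) := by
  have hsum : ∑ p ∈ Fintype.piFinset t, f (p i) =
      (∑ x ∈ t i, f x) * ∏ j ∈ univ.erase i, ((t j).card : ℚ) := by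
    have h := Finset.prod_univ_sum t (fun j x => if j = i then f x else (1 : ℚ))
    rw [← Finset.mul_prod_erase univ _ (Finset.mem_univ i)] at h
    simp only [if_true, Finset.prod_ite_eq', Finset.mem_univ] at h
    rw [← h]
    congr 1
    refine Finset.prod_congr rfl fun j hj => ?_
    simp [Finset.ne_of_mem_erase hj]
  have hcard : ((Fintype.piFinset t).card : ℚ) =
      ((t i).card : ℚ) * ∏ j ∈ univ.erase i, ((t j).card : ℚ) := by
    rw [Fintype.card_piFinset, Nat.cast_prod,
      Finset.mul_prod_erase univ (fun j => ((t j).card : ℚ)) (Finset.mem_univ i)]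
  have hne : ∏ j ∈ univ.erase i, ((t j).card : ℚ) ≠ 0 :=
    Finset.prod_ne_zero_iff.mpr fun j _ => Nat.cast_ne_zero.mpr (ht j).card_ne_zero
  rw [hsum, hcard, mul_div_mul_right _ _ hne]

namespace SimpleGraph

variable {V : Type*} {G : SimpleGraph V}

/-- Two vertices of a set inducing a connected subgraph are joined by a path in that set. -/
theorem exists_isPath_of_induce_connected {s : Set V} (hs : (G.induce s).Connected) {a b : V}
    (ha : a ∈ s) (hb : b ∈ s) : ∃ p : G.Walk a b, p.IsPath ∧ ∀ x ∈ p.support, x ∈ s := by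
  obtain ⟨q, hq⟩ := (hs.preconnected ⟨a, ha⟩ ⟨b, hb⟩).exists_isPath
  refine ⟨q.map (Embedding.induce (G := G) s).toHom,
    hq.map (Embedding.induce (G := G) s).injective, ?_⟩
  intro x hx
  obtain ⟨y, -, rfl⟩ := List.mem_map.mp
    ((Walk.support_map (Embedding.induce (G := G) s).toHom q) ▸ hx)
  exact y.2

/-- A set is connected as soon as each of its vertices is joined to a fixed one by a walk
inside the set. -/
theorem induce_connected_of_forall_exists_walk {s : Set V} {a : V} (ha : a ∈ s)
    (h : ∀ b ∈ s, ∃ p : G.Walk a b, ∀ x ∈ p.support, x ∈ s) : (G.induce s).Connected := by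
  refine induce_connected_of_patches a ha fun {b} hb => ?_
  obtain ⟨p, hp⟩ := h b hb
  exact ⟨{x | x ∈ p.support}, hp, p.start_mem_support, p.end_mem_support,
    p.connected_induce_support.preconnected _ _⟩

theorem IsSubtree.exists_adj_walk {s : Finset V} (hs : G.IsSubtree s) {v w : V} (hv : v ∈ s)
    (hw : w ∈ s) (hwv : w ≠ v) :
    ∃ u, G.Adj v u ∧ ∃ q : G.Walk u w, v ∉ q.support ∧ ∀ x ∈ q.support, x ∈ s := by
  obtain ⟨p, hp, hps⟩ := exists_isPath_of_induce_connected hs.2 (Finset.mem_coe.mpr hv)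
    (Finset.mem_coe.mpr hw)
  cases p with
  | nil => exact absurd rfl hwv
  | @cons _ u _ h q =>
    rw [Walk.cons_isPath_iff] at hp
    exact ⟨u, h, q, hp.2, fun x hx => hps x (by simp [hx])⟩

section Branch

variable [Fintype V]

/-- The vertices that can be reached from `u` by a walk avoiding `v`. -/
noncomputable def branch (G : SimpleGraph V) (v u : V) : Finset V :=
  univ.filter fun w => ∃ q : G.Walk u w, v ∉ q.support

theorem mem_branch {v u w : V} : w ∈ G.branch v u ↔ ∃ q : G.Walk u w, v ∉ q.support := by
  simp [branch]

theorem notMem_branch (v u : V) : v ∉ G.branch v u := by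
  rw [mem_branch]
  rintro ⟨q, hq⟩
  exact hq q.end_mem_support

theorem mem_branch_of_mem_support {v u w x : V} (q : G.Walk u w) (hq : v ∉ q.support)
    (hx : x ∈ q.support) : x ∈ G.branch v u :=
  mem_branch.mpr ⟨q.takeUntil x hx, fun h => hq (q.support_takeUntil_subset_support hx h)⟩

theorem IsAcyclic.eq_of_mem_branch (hG : G.IsAcyclic) {v u u' w : V} (hu : G.Adj v u)
    (hu' : G.Adj v u') (hw : w ∈ G.branch v u) (hw' : w ∈ G.branch v u') : u = u' := by
  obtain ⟨q, hq⟩ := mem_branch.mp hw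
  obtain ⟨q', hq'⟩ := mem_branch.mp hw'
  set r := (q.append q'.reverse).bypass
  have hv : v ∉ r.support := by
    intro h
    have := Walk.support_bypass_subset_support _ h
    rw [Walk.mem_support_append_iff, Walk.support_reverse, List.mem_reverse] at this
    tauto
  have h₁ : (Walk.cons hu r).IsPath := (Walk.bypass_isPath _).cons hv
  have h₂ : (Walk.cons hu' Walk.nil).IsPath := by
    simpa using hu'.ne
  have h := congrArg (fun p : G.Path v u' => p.1.snd)
    ((hG.subsingleton_path v u').elim ⟨_, h₁⟩ ⟨_, h₂⟩)
  simpa using h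

theorem IsSubtree.subset_branch {s : Finset V} (hs : G.IsSubtree s) {v u : V} (hu : u ∈ s)
    (hv : v ∉ s) : s ⊆ G.branch v u := by
  intro w hw
  obtain ⟨p, -, hp⟩ := exists_isPath_of_induce_connected hs.2 (Finset.mem_coe.mpr hu)
    (Finset.mem_coe.mpr hw)
  exact mem_branch.mpr ⟨p, fun h => hv (hp v h)⟩

/-- The part of a subtree through `v` lying in the branch at a neighbour `u` of `v` is empty or a
subtree containing `u`. -/
theorem IsSubtree.inter_branch (hG : G.IsAcyclic) {s : Finset V} (hs : G.IsSubtree s) {v u : V}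
    (hv : v ∈ s) (hu : G.Adj v u) (hne : s ∩ G.branch v u ≠ ∅) :
    G.IsSubtree (s ∩ G.branch v u) ∧ u ∈ s ∩ G.branch v u := by
  have key : ∀ w ∈ s ∩ G.branch v u, ∃ q : G.Walk u w,
      ∀ x ∈ q.support, x ∈ s ∩ G.branch v u := by
    intro w hw
    rw [Finset.mem_inter] at hw
    obtain ⟨u', hu', q, hq, hqs⟩ := hs.exists_adj_walk hv hw.1
      (fun h => notMem_branch v u (h ▸ hw.2))
    obtain rfl := hG.eq_of_mem_branch hu hu' hw.2 (mem_branch.mpr ⟨q, hq⟩)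
    exact ⟨q, fun x hx => Finset.mem_inter.mpr ⟨hqs x hx, mem_branch_of_mem_support q hq hx⟩⟩
  obtain ⟨w, hw⟩ := Finset.nonempty_iff_ne_empty.mpr hne
  obtain ⟨q, hq⟩ := key w hw
  have hmem := hq u q.start_mem_support
  exact ⟨⟨⟨w, hw⟩, induce_connected_of_forall_exists_walk (Finset.mem_coe.mpr hmem)
    fun b hb => key b hb⟩, hmem⟩

end Branch

end SimpleGraph

section Decomposition

variable {V : Type*} [Fintype V]

/-- The subtrees of `G` containing `u` and avoiding `v`, together with the empty set. -/
noncomputable def branchSubtrees (G : SimpleGraph V) (v u : V) : Finset (Finset V) :=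
  insert ∅ ((subtreeFinset G).filter fun s => u ∈ s ∧ v ∉ s)

/-- Join `v` to a family of vertex sets indexed by the neighbours of `v`. -/
noncomputable def glue (G : SimpleGraph V) (v : V) (t : G.neighborFinset v → Finset V) :
    Finset V :=
  insert v (univ.biUnion t)

variable {G : SimpleGraph V} {v : V}

theorem mem_branchSubtrees {u : V} {s : Finset V} :
    s ∈ branchSubtrees G v u ↔ s = ∅ ∨ (G.IsSubtree s ∧ u ∈ s ∧ v ∉ s) := by
  simp [branchSubtrees, subtreeFinset]

theorem empty_notMem_filter_subtreeFinset (u : V) :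
    ∅ ∉ (subtreeFinset G).filter fun s => u ∈ s ∧ v ∉ s := by
  simp

theorem card_branchSubtrees (u : V) :
    (branchSubtrees G v u).card = alphaAvoid G u v + 1 :=
  Finset.card_insert_of_notMem (empty_notMem_filter_subtreeFinset u)

theorem sum_card_branchSubtrees (u : V) :
    ∑ s ∈ branchSubtrees G v u, (s.card : ℚ) = lambdaAvoid G u v * (alphaAvoid G u v : ℚ) := by
  rw [branchSubtrees, Finset.sum_insert (empty_notMem_filter_subtreeFinset u), lambdaAvoid,
    div_mul_cancel_of_imp]
  · simp
  · intro h
    rw [alphaAvoid, Nat.cast_eq_zero, Finset.card_eq_zero] at h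
    rw [h, Finset.sum_empty]

theorem subset_branch_of_mem_branchSubtrees {u : V} {s : Finset V}
    (hs : s ∈ branchSubtrees G v u) : s ⊆ G.branch v u := by
  rcases mem_branchSubtrees.mp hs with rfl | ⟨hs, hu, hv⟩
  · exact Finset.empty_subset _
  · exact hs.subset_branch hu hv

theorem isSubtree_glue {t : G.neighborFinset v → Finset V}
    (ht : ∀ u : G.neighborFinset v, t u ∈ branchSubtrees G v u) : G.IsSubtree (glue G v t) := by
  have hv : v ∈ glue G v t := Finset.mem_insert_self _ _
  refine ⟨⟨v, hv⟩, induce_connected_of_forall_exists_walk (Finset.mem_coe.mpr hv) fun w hw => ?_⟩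
  rcases Finset.mem_insert.mp (Finset.mem_coe.mp hw) with rfl | hw
  · exact ⟨Walk.nil, by simpa using hv⟩
  · obtain ⟨u, -, hwu⟩ := Finset.mem_biUnion.mp hw
    rcases mem_branchSubtrees.mp (ht u) with h | ⟨hs, hu, -⟩
    · simp [h] at hwu
    · obtain ⟨p, -, hp⟩ := exists_isPath_of_induce_connected hs.2 (Finset.mem_coe.mpr hu)
        (Finset.mem_coe.mpr hwu)
      refine ⟨Walk.cons ((G.mem_neighborFinset v u).mp u.2) p, fun x hx => ?_⟩
      rcases List.mem_cons.mp (Walk.support_cons _ _ ▸ hx) with rfl | hx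
      · exact hv
      · exact Finset.mem_insert_of_mem (Finset.mem_biUnion.mpr ⟨u, Finset.mem_univ _, hp x hx⟩)

theorem glue_inter_branch (hG : G.IsAcyclic) {t : G.neighborFinset v → Finset V}
    (ht : ∀ u : G.neighborFinset v, t u ∈ branchSubtrees G v u) (u : G.neighborFinset v) :
    glue G v t ∩ G.branch v u = t u := by
  ext w
  simp only [glue, Finset.mem_inter, Finset.mem_insert, Finset.mem_biUnion, Finset.mem_univ,
    true_and]
  constructor
  · rintro ⟨rfl | ⟨u', hw⟩, hwu⟩
    · exact absurd hwu (notMem_branch _ _)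
    · have h := hG.eq_of_mem_branch ((G.mem_neighborFinset v u).mp u.2)
        ((G.mem_neighborFinset v u').mp u'.2) hwu (subset_branch_of_mem_branchSubtrees (ht u') hw)
      rwa [Subtype.ext h]
  · exact fun hw => ⟨Or.inr ⟨u, hw⟩, subset_branch_of_mem_branchSubtrees (ht u) hw⟩

theorem glue_inter_branch_eq_self {s : Finset V} (hs : G.IsSubtree s) (hv : v ∈ s) :
    glue G v (fun u => s ∩ G.branch v u) = s := by
  ext w
  simp only [glue, Finset.mem_inter, Finset.mem_insert, Finset.mem_biUnion, Finset.mem_univ,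
    true_and]
  constructor
  · rintro (rfl | ⟨u, hw, -⟩) <;> assumption
  · intro hw
    by_cases hwv : w = v
    · exact Or.inl hwv
    · obtain ⟨u, hu, q, hq, -⟩ := hs.exists_adj_walk hv hw hwv
      exact Or.inr ⟨⟨u, (G.mem_neighborFinset v u).mpr hu⟩, hw, mem_branch.mpr ⟨q, hq⟩⟩

theorem card_glue (hG : G.IsAcyclic) {t : G.neighborFinset v → Finset V}
    (ht : ∀ u : G.neighborFinset v, t u ∈ branchSubtrees G v u) :
    (glue G v t).card = 1 + ∑ u, (t u).card := by
  rw [glue, Finset.card_insert_of_notMem, Finset.card_biUnion, add_comm]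
  · intro u _ u' _ hne
    refine Finset.disjoint_left.mpr fun w hw hw' => hne (Subtype.ext ?_)
    exact hG.eq_of_mem_branch ((G.mem_neighborFinset v u).mp u.2)
      ((G.mem_neighborFinset v u').mp u'.2) (subset_branch_of_mem_branchSubtrees (ht u) hw)
      (subset_branch_of_mem_branchSubtrees (ht u') hw')
  · intro h
    obtain ⟨u, -, hu⟩ := Finset.mem_biUnion.mp h
    exact notMem_branch _ _ (subset_branch_of_mem_branchSubtrees (ht u) hu)

/-- Sums over the subtrees through `v` are sums over the choices, in each branch at `v`, of the
empty set or a subtree containing the neighbour of `v`. -/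
theorem sum_subtrees_eq_sum_piFinset (hG : G.IsAcyclic) (f : Finset V → ℚ) :
    ∑ s ∈ (subtreeFinset G).filter (fun s => v ∈ s), f s =
      ∑ t ∈ Fintype.piFinset fun u : G.neighborFinset v => branchSubtrees G v u,
        f (glue G v t) := by
  refine Finset.sum_nbij' (fun s u => s ∩ G.branch v u) (glue G v) ?_ ?_ ?_ ?_ ?_
  · intro s hs
    simp only [subtreeFinset, Finset.mem_filter, Finset.mem_univ, true_and] at hs
    refine Fintype.mem_piFinset.mpr fun u => mem_branchSubtrees.mpr ?_
    refine or_iff_not_imp_left.mpr fun hne => ?_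
    obtain ⟨h, hu⟩ := hs.1.inter_branch hG hs.2 ((G.mem_neighborFinset v u).mp u.2) hne
    exact ⟨h, hu, fun hv => notMem_branch _ _ (Finset.mem_inter.mp hv).2⟩
  · intro t ht
    simp only [subtreeFinset, Finset.mem_filter, Finset.mem_univ, true_and]
    exact ⟨isSubtree_glue (Fintype.mem_piFinset.mp ht), Finset.mem_insert_self _ _⟩
  · intro s hs
    simp only [subtreeFinset, Finset.mem_filter, Finset.mem_univ, true_and] at hs
    exact glue_inter_branch_eq_self hs.1 hs.2
  · intro t ht
    exact funext (glue_inter_branch hG (Fintype.mem_piFinset.mp ht))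
  · intro s hs
    simp only [subtreeFinset, Finset.mem_filter, Finset.mem_univ, true_and] at hs
    rw [glue_inter_branch_eq_self hs.1 hs.2]

end Decomposition

/-- If `v` is a vertex of a tree `T` with neighbours `v₁, …, v_d` and `T_i` is the
component of `T - v` containing `v_i`, then
`λ(T,v) = 1 + ∑ᵢ λ(Tᵢ,vᵢ)·α(Tᵢ,vᵢ)/(α(Tᵢ,vᵢ) + 1)`. -/
theorem lambda_eq_one_add_sum {V : Type*} [Fintype V] (G : SimpleGraph V)
    (hT : G.IsTree) (v : V) :
    lambdaV G v = 1 + ∑ u ∈ G.neighborFinset v,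
      lambdaAvoid G u v * (alphaAvoid G u v : ℚ) / ((alphaAvoid G u v : ℚ) + 1) := by
  have hG : G.IsAcyclic := hT.isAcyclic
  set P := Fintype.piFinset fun u : G.neighborFinset v => branchSubtrees G v u with hP
  have hne : ∀ u : G.neighborFinset v, (branchSubtrees G v (u : V)).Nonempty := fun u =>
    Finset.insert_nonempty _ _
  have hcard : (((subtreeFinset G).filter (fun s => v ∈ s)).card : ℚ) = P.card := by
    simpa only [Finset.sum_const, nsmul_eq_mul, mul_one] using
      sum_subtrees_eq_sum_piFinset (v := v) hG (fun _ => 1)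
  have hP0 : (P.card : ℚ) ≠ 0 :=
    Nat.cast_ne_zero.mpr (Fintype.piFinset_nonempty.mpr hne).card_ne_zero
  have hsum : ∑ t ∈ P, ((glue G v t).card : ℚ) =
      P.card + ∑ u, ∑ t ∈ P, ((t u).card : ℚ) := by
    have h : ∀ t ∈ P, ((glue G v t).card : ℚ) = 1 + ∑ u, ((t u).card : ℚ) := fun t ht => by
      rw [card_glue hG (Fintype.mem_piFinset.mp ht), Nat.cast_add, Nat.cast_one, Nat.cast_sum]
    rw [Finset.sum_congr rfl h, Finset.sum_add_distrib, Finset.sum_comm, Finset.sum_const,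
      nsmul_eq_mul, mul_one]
  rw [lambdaV, sum_subtrees_eq_sum_piFinset hG, hcard, hsum, add_div, div_self hP0,
    Finset.sum_div, ← Finset.sum_coe_sort (G.neighborFinset v)]
  congr 1
  refine Finset.sum_congr rfl fun u _ => ?_
  rw [hP, Fintype.sum_piFinset_eval_div_card _ hne u (fun s => (s.card : ℚ)),
    sum_card_branchSubtrees, card_branchSubtrees, Nat.cast_add, Nat.cast_one]
end

section
/- If T is a rooted tree in 𝒯₃* with root v, then α(T,v) ≥ ᾱ(T,v), i.e. at least half of the subtrees of T contain the root. -/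
open SimpleGraph Finset BigOperators Filter

attribute [local instance] Classical.propDecidable

/-- `α(G,v)`: the number of subtrees of `G` containing the vertex `v`. -/
noncomputable def alphaV {V : Type*} [Fintype V] (G : SimpleGraph V) (v : V) : ℕ :=
  ((subtreeFinset G).filter (fun s => v ∈ s)).card

/-- `ᾱ(G,v)`: the number of subtrees of `G` not containing the vertex `v`. -/
noncomputable def alphaBarV {V : Type*} [Fintype V] (G : SimpleGraph V) (v : V) : ℕ :=
  ((subtreeFinset G).filter (fun s => v ∉ s)).card

/-- The rooted tree `(G, v)` is in the class 𝒯₃*: `G` is a tree and either it is a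
single vertex, or the root `v` has degree at least 2 and every other internal
vertex has degree at least 3. -/
noncomputable def InT3Star {V : Type*} [Fintype V] (G : SimpleGraph V) (v : V) : Prop :=
  G.IsTree ∧ (Fintype.card V = 1 ∨
    (2 ≤ G.degree v ∧ ∀ w, w ≠ v → 2 ≤ G.degree w → 3 ≤ G.degree w))

namespace SimpleGraph

/-- `par` and `d` are the parent and depth functions of `G` rooted at `v`; the root is its own
parent. -/
structure IsParentMap {V : Type*} (G : SimpleGraph V) (v : V) (par : V → V) (d : V → ℕ) :
    Prop where
  root : par v = v
  adj_parent : ∀ {x}, x ≠ v → G.Adj x (par x)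
  parent_or_parent : ∀ {x y}, G.Adj x y → par x = y ∨ par y = x
  depth_root : d v = 0
  depth_parent : ∀ {x}, x ≠ v → d (par x) + 1 = d x

theorem IsTree.exists_isParentMap {V : Type*} {G : SimpleGraph V} (hG : G.IsTree) (v : V) :
    ∃ par d, G.IsParentMap v par d := by
  choose f hf hf' using (hG.existsUnique_path · v)
  have hroot : f v = .nil := (hf' v _ Walk.IsPath.nil).symm
  refine ⟨fun x => (f x).snd, fun x => (f x).length, ?_, ?_, ?_, ?_, ?_⟩
  · simp [hroot]
  · intro x hx
    exact (f x).adj_snd (Walk.not_nil_of_ne hx)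
  · intro x y hxy
    by_cases hy : y ∈ (f x).support
    · exact .inl (hG.isAcyclic.eq_snd_of_adj_start (hf x) hxy hy).symm
    · right
      rw [← hf' y (.cons hxy.symm (f x)) ((Walk.cons_isPath_iff _ _).2 ⟨hf x, hy⟩)]
      simp
  · simp [hroot]
  · intro x hx
    have h := hf' _ _ (hf x).tail
    rw [← h]
    exact Walk.length_tail_add_one (Walk.not_nil_of_ne hx)

end SimpleGraph

/-- `x` is a descendant of `w`, possibly `w` itself, for the parent function `par`. -/
def IsDescendant {V : Type*} (par : V → V) (w x : V) : Prop :=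
  ∃ k, par^[k] x = w

/-- The set `s` has highest vertex `w` and contains the parents of its other vertices. -/
def HasTop {V : Type*} (par : V → V) (v : V) (s : Finset V) (w : V) : Prop :=
  w ∈ s ∧ ∀ x ∈ s, x ≠ w → x ≠ v ∧ par x ∈ s

/-- Extend a subtree `s` with top `w` by the path from `w` to the root and, unless `s` is
a singleton, by the further vertex `u`. -/
noncomputable def extendToRoot {V : Type*} [Fintype V] (par : V → V) (w u : V) (s : Finset V) :
    Finset V :=
  if s = {w} then univ.filter (IsDescendant par · w)
  else insert u (univ.filter (IsDescendant par · w) ∪ s)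

namespace IsDescendant

variable {V : Type*} {par : V → V} {a b x y w : V}

theorem refl (x : V) : IsDescendant par x x := ⟨0, rfl⟩

theorem parent (x : V) : IsDescendant par (par x) x := ⟨1, rfl⟩

theorem trans (h : IsDescendant par a b) (h' : IsDescendant par b x) : IsDescendant par a x := by
  obtain ⟨k, rfl⟩ := h
  obtain ⟨l, rfl⟩ := h'
  exact ⟨k + l, Function.iterate_add_apply _ _ _ _⟩

theorem of_ne (h : IsDescendant par w x) (hne : x ≠ w) : IsDescendant par w (par x) := by
  obtain ⟨_ | k, hk⟩ := h
  · exact absurd hk hne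
  · exact ⟨k, hk⟩

theorem total (ha : IsDescendant par a x) (hb : IsDescendant par b x) :
    IsDescendant par a b ∨ IsDescendant par b a := by
  obtain ⟨k, rfl⟩ := ha
  obtain ⟨l, rfl⟩ := hb
  rcases le_total k l with h | h
  · exact .inr ⟨l - k, by rw [← Function.iterate_add_apply, Nat.sub_add_cancel h]⟩
  · exact .inl ⟨k - l, by rw [← Function.iterate_add_apply, Nat.sub_add_cancel h]⟩

end IsDescendant

namespace SimpleGraph.IsParentMap

variable {V : Type*} {G : SimpleGraph V} {v : V} {par : V → V} {d : V → ℕ}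

theorem eq_or_depth_lt (hp : G.IsParentMap v par d) {w x : V} (h : IsDescendant par w x) :
    w = x ∨ d w < d x := by
  obtain ⟨k, hk⟩ := h
  induction k generalizing x with
  | zero => exact .inl hk.symm
  | succ k ih =>
    rw [Function.iterate_succ_apply] at hk
    by_cases hx : x = v
    · subst hx
      rw [hp.root] at hk
      exact ih hk
    · have := hp.depth_parent hx
      rcases ih hk with rfl | h
      · right; lia
      · right; lia

theorem eq_of_depth_eq (hp : G.IsParentMap v par d) {a b x : V} (ha : IsDescendant par a x)
    (hb : IsDescendant par b x) (hd : d a = d b) : a = b := by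
  rcases ha.total hb with h | h <;> rcases hp.eq_or_depth_lt h with h | h <;> lia

theorem isDescendant_root (hp : G.IsParentMap v par d) (x : V) : IsDescendant par v x := by
  induction hn : d x using Nat.strong_induction_on generalizing x with
  | _ n ih =>
    by_cases hx : x = v
    · subst hx; exact .refl _
    · have := hp.depth_parent hx
      exact (ih _ (by lia) _ rfl).trans (.parent x)

theorem isDescendant_of_hasTop (hp : G.IsParentMap v par d) {s : Finset V} {w : V}
    (h : HasTop par v s w) {x : V} (hx : x ∈ s) : IsDescendant par w x := by
  induction hn : d x using Nat.strong_induction_on generalizing x with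
  | _ n ih =>
    by_cases hxw : x = w
    · subst hxw; exact .refl _
    · obtain ⟨hxv, hxs⟩ := h.2 x hx hxw
      have := hp.depth_parent hxv
      exact (ih _ (by lia) hxs rfl).trans (.parent x)

theorem isSubtree_of_hasTop (hp : G.IsParentMap v par d) {s : Finset V} {w : V}
    (h : HasTop par v s w) : G.IsSubtree s := by
  refine ⟨⟨w, h.1⟩, ?_⟩
  rw [connected_iff_exists_forall_reachable]
  refine ⟨⟨w, h.1⟩, ?_⟩
  rintro ⟨x, hx⟩
  induction hn : d x using Nat.strong_induction_on generalizing x with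
  | _ n ih =>
    by_cases hxw : x = w
    · subst hxw; exact .refl _
    · obtain ⟨hxv, hxs⟩ := h.2 x hx hxw
      have := hp.depth_parent hxv
      refine (ih _ (by lia) (par x) hxs rfl).trans (Adj.reachable ?_)
      exact (hp.adj_parent hxv).symm

theorem exists_hasTop (hp : G.IsParentMap v par d) {s : Finset V} (h : G.IsSubtree s) :
    ∃ w, HasTop par v s w := by
  obtain ⟨w, hw, hmin⟩ := s.exists_min_image d h.1
  refine ⟨w, hw, fun x hx hxw => ?_⟩
  have hxv : x ≠ v := by
    rintro rfl
    rcases hp.eq_or_depth_lt (hp.isDescendant_root w) with h' | h'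
    · exact hxw h'
    · have := hmin x hx
      lia
  refine ⟨hxv, by_contra fun hpx => ?_⟩
  have key : ∀ y : (s : Set V), (G.induce (s : Set V)).Reachable ⟨x, hx⟩ y →
      IsDescendant par x y := by
    rintro y ⟨p⟩
    suffices ∀ (a b : (s : Set V)) (p : (G.induce (s : Set V)).Walk a b),
        IsDescendant par x a → IsDescendant par x b from this _ _ p (.refl x)
    intro a b p
    induction p with
    | nil => exact id
    | @cons a b c hab p ih =>
      intro ha
      apply ih
      have hab' : G.Adj a b := hab
      rcases hp.parent_or_parent hab' with h' | h'
      · rw [← h']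
        refine ha.of_ne fun hax => hpx ?_
        rw [← hax, h']
        exact b.2
      · rw [← h'] at ha
        exact ha.trans (.parent _)
  have hxw' := key ⟨w, hw⟩ (h.2.preconnected _ _)
  rcases hp.eq_or_depth_lt hxw' with h' | h'
  · exact hxw h'
  · have := hmin x hx
    simp only at h'
    lia

theorem exists_sibling [Fintype V] (hp : G.IsParentMap v par d) (hroot : 2 ≤ G.degree v)
    (hint : ∀ w, w ≠ v → 2 ≤ G.degree w → 3 ≤ G.degree w) {w : V} (hw : w ≠ v) :
    ∃ u, u ≠ w ∧ u ≠ v ∧ par u = par w := by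
  have hwp := (hp.adj_parent hw).symm
  by_cases hpv : par w = v
  · rw [hpv] at hwp ⊢
    have h1 : 1 < (G.neighborFinset v).card := by rw [card_neighborFinset_eq_degree]; lia
    obtain ⟨u, hu, huw⟩ := exists_mem_ne h1 w
    rw [mem_neighborFinset] at hu
    refine ⟨u, huw, hu.ne', ?_⟩
    rcases hp.parent_or_parent hu with h | h
    · exact absurd (hp.root.symm.trans h) hu.ne
    · exact h
  · have hpp := hp.adj_parent hpv
    have hne : w ≠ par (par w) := by
      intro h
      have h1 := hp.depth_parent hw
      have h2 := hp.depth_parent hpv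
      rw [← h] at h2
      lia
    have hsub : {w, par (par w)} ⊆ G.neighborFinset (par w) := by
      intro y hy
      rw [mem_insert, mem_singleton] at hy
      rw [mem_neighborFinset]
      rcases hy with rfl | rfl <;> assumption
    have h2 : 2 ≤ G.degree (par w) := by
      rw [← card_neighborFinset_eq_degree, ← card_pair hne]
      exact card_le_card hsub
    have h3 := hint _ hpv h2
    have h4 : ({w, par (par w)} : Finset V).card < (G.neighborFinset (par w)).card := by
      rw [card_pair hne, card_neighborFinset_eq_degree]; lia
    obtain ⟨u, hu, hu'⟩ := exists_mem_notMem_of_card_lt_card h4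
    rw [mem_neighborFinset] at hu
    simp only [mem_insert, mem_singleton, not_or] at hu'
    rcases hp.parent_or_parent hu with h | h
    · exact absurd h.symm hu'.2
    · refine ⟨u, hu'.1, ?_, h⟩
      rintro rfl
      exact hpv (h.symm.trans hp.root)

variable [Fintype V]

theorem root_mem_extendToRoot (hp : G.IsParentMap v par d) (w u : V) (s : Finset V) :
    v ∈ extendToRoot par w u s := by
  have := hp.isDescendant_root w
  unfold extendToRoot
  split_ifs <;> simp [this]

theorem hasTop_extendToRoot (hp : G.IsParentMap v par d) {s : Finset V} {w u : V}
    (h : HasTop par v s w) (hu : par u = par w) : HasTop par v (extendToRoot par w u s) v := by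
  refine ⟨hp.root_mem_extendToRoot w u s, fun x hx hxv => ⟨hxv, ?_⟩⟩
  have hanc : ∀ {y}, IsDescendant par y w → IsDescendant par (par y) w :=
    fun hy => (IsDescendant.parent _).trans hy
  unfold extendToRoot at hx ⊢
  split_ifs at hx ⊢
  · simp only [mem_filter, mem_univ, true_and] at hx ⊢
    exact hanc hx
  · simp only [mem_insert, mem_union, mem_filter, mem_univ, true_and] at hx ⊢
    rcases hx with rfl | hx | hx
    · rw [hu]
      exact .inr (.inl (.parent w))
    · exact .inr (.inl (hanc hx))
    · by_cases hxw : x = w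
      · subst hxw
        exact .inr (.inl (.parent x))
      · exact .inr (.inr (h.2 x hx hxw).2)

theorem filter_isDescendant_extendToRoot (hp : G.IsParentMap v par d) {s : Finset V} {w u : V}
    (h : HasTop par v s w) (hne : u ≠ w) (hd : d u = d w) :
    (extendToRoot par w u s).filter (IsDescendant par w ·) = s := by
  have hanti : ∀ {x}, IsDescendant par x w → IsDescendant par w x → x = w := by
    intro x h1 h2
    rcases hp.eq_or_depth_lt h1 with h1 | h1
    · exact h1
    · rcases hp.eq_or_depth_lt h2 with h2 | h2
      · exact h2.symm
      · lia
  ext x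
  unfold extendToRoot
  split_ifs with hs
  · rw [hs]
    simp only [mem_filter, mem_univ, true_and, mem_singleton]
    refine ⟨fun hx => hanti hx.1 hx.2, ?_⟩
    rintro rfl
    exact ⟨.refl x, .refl x⟩
  · simp only [mem_insert, mem_union, mem_filter, mem_univ, true_and]
    constructor
    · rintro ⟨rfl | hx | hx, hx'⟩
      · exact absurd (hp.eq_of_depth_eq (.refl x) hx' hd) hne
      · rw [hanti hx hx']
        exact h.1
      · exact hx
    · exact fun hx => ⟨.inr (.inr hx), hp.isDescendant_of_hasTop h hx⟩

theorem not_isDescendant_of_extendToRoot_eq (hp : G.IsParentMap v par d) {s s' : Finset V}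
    {w w' u u' : V} (h' : HasTop par v s' w') (hne : u ≠ w) (hd : d u = d w)
    (hd' : d u' = d w') (hs : s ≠ {w}) (hs' : s' ≠ {w'})
    (heq : extendToRoot par w u s = extendToRoot par w' u' s') (hww : w ≠ w') :
    ¬ IsDescendant par w w' := by
  intro hdesc
  have hlt := (hp.eq_or_depth_lt hdesc).resolve_left hww
  have hu : u ∈ extendToRoot par w' u' s' := by
    rw [← heq, extendToRoot, if_neg hs]
    exact mem_insert_self _ _
  rw [extendToRoot, if_neg hs'] at hu
  simp only [mem_insert, mem_union, mem_filter, mem_univ, true_and] at hu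
  rcases hu with rfl | hu | hu
  · lia
  · exact hne (hp.eq_of_depth_eq hu hdesc hd)
  · exact hne (hp.eq_of_depth_eq (.refl u) (hdesc.trans (hp.isDescendant_of_hasTop h' hu)) hd)

theorem extendToRoot_singleton_ne (hp : G.IsParentMap v par d) {s' : Finset V} {w w' u u' : V}
    (hne : u' ≠ w') (hd : d u' = d w') (hs' : s' ≠ {w'}) :
    extendToRoot par w u {w} ≠ extendToRoot par w' u' s' := by
  intro heq
  rw [extendToRoot, if_pos rfl, extendToRoot, if_neg hs'] at heq
  have h1 : u' ∈ univ.filter (IsDescendant par · w) := by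
    rw [heq]; exact mem_insert_self _ _
  have h2 : w' ∈ univ.filter (IsDescendant par · w) := by
    rw [heq]; simp [IsDescendant.refl]
  simp only [mem_filter, mem_univ, true_and] at h1 h2
  exact hne (hp.eq_of_depth_eq h1 h2 hd)

theorem top_eq_of_extendToRoot_eq (hp : G.IsParentMap v par d) {s s' : Finset V}
    {w w' u u' : V} (h : HasTop par v s w) (h' : HasTop par v s' w')
    (hne : u ≠ w) (hne' : u' ≠ w') (hd : d u = d w) (hd' : d u' = d w')
    (heq : extendToRoot par w u s = extendToRoot par w' u' s') : w = w' := by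
  by_cases hs : s = {w}
  · by_cases hs' : s' = {w'}
    · rw [extendToRoot, if_pos hs, extendToRoot, if_pos hs'] at heq
      have h1 : w ∈ univ.filter (IsDescendant par · w') := by
        rw [← heq]; simp [IsDescendant.refl]
      have h2 : w' ∈ univ.filter (IsDescendant par · w) := by
        rw [heq]; simp [IsDescendant.refl]
      simp only [mem_filter, mem_univ, true_and] at h1 h2
      rcases hp.eq_or_depth_lt h1 with h1 | h1
      · exact h1
      · rcases hp.eq_or_depth_lt h2 with h2 | h2
        · exact h2.symm
        · lia
    · rw [hs] at heq
      exact absurd heq (hp.extendToRoot_singleton_ne hne' hd' hs')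
  by_cases hs' : s' = {w'}
  · rw [hs'] at heq
    exact absurd heq.symm (hp.extendToRoot_singleton_ne hne hd hs)
  by_contra hww
  have hA := hp.not_isDescendant_of_extendToRoot_eq h' hne hd hd' hs hs' heq hww
  have hB := hp.not_isDescendant_of_extendToRoot_eq h hne' hd' hd hs' hs heq.symm (Ne.symm hww)
  have hsub : ∀ {x}, x ∈ s → x = u' ∨ IsDescendant par x w' ∨ x ∈ s' := by
    intro x hx
    have : x ∈ extendToRoot par w' u' s' := by
      rw [← heq, extendToRoot, if_neg hs]
      simp [hx]
    rw [extendToRoot, if_neg hs'] at this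
    simpa using this
  have hwu : w = u' := by
    rcases hsub h.1 with hw | hw | hw
    · exact hw
    · exact absurd hw hA
    · exact absurd (hp.isDescendant_of_hasTop h' hw) hB
  obtain ⟨x, hx, hxw⟩ : ∃ x ∈ s, x ≠ w := by
    by_contra! hall
    exact hs (eq_singleton_iff_unique_mem.2 ⟨h.1, hall⟩)
  have hwx := hp.isDescendant_of_hasTop h hx
  rcases hsub hx with hx' | hx' | hx'
  · exact hxw (hx'.trans hwu.symm)
  · exact hA (hwx.trans hx')
  · exact hww (hp.eq_of_depth_eq hwx (hp.isDescendant_of_hasTop h' hx') (by rw [hwu, hd']))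

end SimpleGraph.IsParentMap

/-- If `T ∈ 𝒯₃*` has root `v` then `α(T,v) ≥ ᾱ(T,v)`: at least half of the
subtrees of `T` contain the root. -/
theorem alphaBar_le_alpha {V : Type*} [Fintype V] (G : SimpleGraph V) (v : V)
    (h : InT3Star G v) : alphaBarV G v ≤ alphaV G v := by
  obtain ⟨hG, hcard | ⟨hroot, hint⟩⟩ := h
  · have hsub := Fintype.card_le_one_iff_subsingleton.1 hcard.le
    have : alphaBarV G v = 0 := by
      simp only [alphaBarV, subtreeFinset, card_eq_zero, filter_eq_empty_iff, mem_filter, mem_univ,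
        true_and, not_not]
      rintro s ⟨⟨x, hx⟩, -⟩
      rwa [Subsingleton.elim v x]
    lia
  obtain ⟨par, d, hp⟩ := hG.exists_isParentMap v
  have htop : ∀ s, ∃ w, G.IsSubtree s → HasTop par v s w := by
    intro s
    by_cases hs : G.IsSubtree s
    · exact (hp.exists_hasTop hs).imp fun w hw _ => hw
    · exact ⟨v, fun hs' => absurd hs' hs⟩
  have hsib : ∀ w, ∃ u, w ≠ v → u ≠ w ∧ u ≠ v ∧ par u = par w := by
    intro w
    by_cases hw : w = v
    · exact ⟨v, fun hw' => absurd hw hw'⟩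
    · exact (hp.exists_sibling hroot hint hw).imp fun u hu _ => hu
  choose top htop using htop
  choose sib hsib using hsib
  have hprop : ∀ s ∈ (subtreeFinset G).filter (fun s => v ∉ s), HasTop par v s (top s) ∧
      sib (top s) ≠ top s ∧ par (sib (top s)) = par (top s) ∧ d (sib (top s)) = d (top s) := by
    intro s hs
    simp only [subtreeFinset, mem_filter, mem_univ, true_and] at hs
    have ht := htop s hs.1
    have hv : top s ≠ v := fun hv => hs.2 (hv ▸ ht.1)
    obtain ⟨h1, h2, h3⟩ := hsib _ hv
    refine ⟨ht, h1, h3, ?_⟩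
    rw [← hp.depth_parent h2, ← hp.depth_parent hv, h3]
  refine card_le_card_of_injOn (fun s => extendToRoot par (top s) (sib (top s)) s) ?_ ?_
  · intro s hs
    obtain ⟨ht, -, hpar, -⟩ := hprop s hs
    have := hp.hasTop_extendToRoot ht hpar
    simpa [subtreeFinset] using ⟨hp.isSubtree_of_hasTop this, this.1⟩
  · intro s hs s' hs' heq
    obtain ⟨ht, hne, -, hd⟩ := hprop s hs
    obtain ⟨ht', hne', -, hd'⟩ := hprop s' hs'
    have hw := hp.top_eq_of_extendToRoot_eq ht ht' hne hne' hd hd' heq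
    rw [← hp.filter_isDescendant_extendToRoot ht hne hd,
      ← hp.filter_isDescendant_extendToRoot ht' hne' hd']
    simp only at heq
    rw [heq, hw]
end

section
/- Let T be a rooted tree with root v, n vertices, and l leaves, where the root is not counted as a leaf even if it has degree at most 1. Then α(T,v) ≥ n − l − 1 + 2^l. -/
open SimpleGraph Finset BigOperators Filter

attribute [local instance] Classical.propDecidable

/-- An interior vertex of a path does not have a unique neighbour. -/
theorem SimpleGraph.Walk.IsPath.not_existsUnique_adj {V : Type*} {G : SimpleGraph V} {x : V}
    {a b : V} {p : G.Walk a b} (hp : p.IsPath) (hx : x ∈ p.support) (hxa : x ≠ a) (hxb : x ≠ b) :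
    ¬ ∃! y, G.Adj x y := by
  induction p with
  | nil => simp_all
  | @cons a c b h p ih =>
    rw [Walk.cons_isPath_iff] at hp
    have hx' : x ∈ p.support := by simpa [hxa] using hx
    by_cases hxc : x = c
    · subst hxc
      cases p with
      | nil => exact absurd rfl hxb
      | @cons _ d _ h' q =>
        intro hu
        have : a = d := hu.unique h.symm h'
        subst this
        exact hp.2 (by simp)
    · exact ih hp.1 hx' hxc hxb

/-- A set of vertices is a subtree as soon as each of its members is joined to a fixed member
by a walk inside the set. -/
theorem SimpleGraph.isSubtree_of_walks {V : Type*} {G : SimpleGraph V} {s : Finset V} {v : V}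
    (hv : v ∈ s) (h : ∀ u ∈ s, ∃ p : G.Walk v u, ∀ x ∈ p.support, x ∈ s) : G.IsSubtree s := by
  refine ⟨⟨v, hv⟩, induce_connected_of_patches v (by simpa using hv) ?_⟩
  intro u hu
  obtain ⟨p, hp⟩ := h u (by simpa using hu)
  exact ⟨{x | x ∈ p.support}, fun x hx => by simpa using hp x hx, p.start_mem_support,
    p.end_mem_support, p.connected_induce_support _ _⟩

/-- The vertices that can be reached from `v` without passing through `w`. -/
noncomputable def SimpleGraph.reachableAvoiding {V : Type*} [Fintype V] (G : SimpleGraph V)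
    (v w : V) : Finset V :=
  Finset.univ.filter fun u => ∃ p : G.Walk v u, w ∉ p.support

theorem SimpleGraph.mem_reachableAvoiding {V : Type*} [Fintype V] {G : SimpleGraph V} {v w u : V} :
    u ∈ G.reachableAvoiding v w ↔ ∃ p : G.Walk v u, w ∉ p.support := by
  simp [reachableAvoiding]

theorem SimpleGraph.notMem_reachableAvoiding {V : Type*} [Fintype V] (G : SimpleGraph V)
    (v w : V) : w ∉ G.reachableAvoiding v w := by
  simp [mem_reachableAvoiding]

theorem SimpleGraph.root_mem_reachableAvoiding {V : Type*} [Fintype V] (G : SimpleGraph V)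
    {v w : V} (h : w ≠ v) : v ∈ G.reachableAvoiding v w :=
  mem_reachableAvoiding.2 ⟨Walk.nil, by simpa using h⟩

theorem SimpleGraph.isSubtree_reachableAvoiding {V : Type*} [Fintype V] (G : SimpleGraph V)
    {v w : V} (h : w ≠ v) : G.IsSubtree (G.reachableAvoiding v w) := by
  refine isSubtree_of_walks (G.root_mem_reachableAvoiding h) fun u hu => ?_
  obtain ⟨p, hp⟩ := mem_reachableAvoiding.1 hu
  exact ⟨p, fun x hx => mem_reachableAvoiding.2
    ⟨p.takeUntil x hx, fun hw => hp (p.support_takeUntil_subset_support hx hw)⟩⟩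

theorem SimpleGraph.Connected.mem_reachableAvoiding_of_dist_le {V : Type*} [Fintype V]
    {G : SimpleGraph V} (hG : G.Connected) {v w u : V} (hne : u ≠ w)
    (h : G.dist v u ≤ G.dist v w) : u ∈ G.reachableAvoiding v w := by
  obtain ⟨p, hp⟩ := hG.exists_walk_length_eq_dist v u
  refine mem_reachableAvoiding.2 ⟨p, fun hw => ?_⟩
  have h₁ := dist_le (p.takeUntil w hw)
  have h₂ := p.length_takeUntil_lt_length hw hne.symm
  omega

theorem SimpleGraph.Connected.reachableAvoiding_injective {V : Type*} [Fintype V]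
    {G : SimpleGraph V} (hG : G.Connected) (v : V) :
    Function.Injective (G.reachableAvoiding v) := by
  intro w₁ w₂ h
  by_contra hne
  rcases le_total (G.dist v w₁) (G.dist v w₂) with hd | hd
  · exact G.notMem_reachableAvoiding v w₁ (h.symm ▸ hG.mem_reachableAvoiding_of_dist_le hne hd)
  · exact G.notMem_reachableAvoiding v w₂
      (h ▸ hG.mem_reachableAvoiding_of_dist_le (Ne.symm hne) hd)

/-- Deleting non-root leaves from a connected graph leaves a subtree. -/
theorem SimpleGraph.Connected.isSubtree_compl_of_leaves {V : Type*} [Fintype V]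
    {G : SimpleGraph V} (hG : G.Connected) {v : V} {s : Finset V}
    (hs : ∀ w ∈ s, w ≠ v ∧ G.degree w = 1) : G.IsSubtree sᶜ := by
  refine isSubtree_of_walks (v := v) (by simpa using fun h => (hs v h).1 rfl) fun u hu => ?_
  obtain ⟨p, hp⟩ := hG.exists_isPath v u
  refine ⟨p, fun x hx => Finset.mem_compl.2 fun hxs => ?_⟩
  exact hp.not_existsUnique_adj hx (hs x hxs).1
    (fun h => Finset.mem_compl.1 hu (h ▸ hxs)) (degree_eq_one_iff_existsUnique_adj.1 (hs x hxs).2)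

/-- If `T` is a tree rooted at `v` with `n` vertices and `l` leaves (where a leaf
is a non-root vertex of degree one), then `α(T,v) ≥ n - l - 1 + 2^l`. -/
theorem alpha_ge_of_rooted {V : Type*} [Fintype V] (G : SimpleGraph V)
    (hT : G.IsTree) (v : V) (l : ℕ)
    (hl : l = (Finset.univ.filter (fun w => w ≠ v ∧ G.degree w = 1)).card) :
    (Fintype.card V : ℤ) - l - 1 + 2 ^ l ≤ (alphaV G v : ℤ) := by
  have hG : G.Connected := hT.connected
  set L := Finset.univ.filter (fun w => w ≠ v ∧ G.degree w = 1) with hL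
  have hLmem : ∀ w ∈ L, w ≠ v ∧ G.degree w = 1 := fun w hw => by simpa [hL] using hw
  have hvL : v ∉ L := fun h => (hLmem v h).1 rfl
  have hI : (insert v L)ᶜ.card + (l + 1) = Fintype.card V := by
    rw [hl, ← Finset.card_insert_of_notMem hvL, Finset.card_compl_add_card]
  have hdisj : Disjoint (L.powerset.image compl)
      ((insert v L)ᶜ.image (G.reachableAvoiding v)) := by
    rw [Finset.disjoint_left]
    intro t ht ht'
    obtain ⟨s, hs, rfl⟩ := Finset.mem_image.1 ht
    obtain ⟨w, hw, hws⟩ := Finset.mem_image.1 ht'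
    have hws' : w ∉ sᶜ := hws ▸ G.notMem_reachableAvoiding v w
    have hwL : w ∈ L := Finset.mem_powerset.1 hs (by simpa using hws')
    exact Finset.mem_compl.1 hw (Finset.mem_insert_of_mem hwL)
  have hle : 2 ^ l + (insert v L)ᶜ.card ≤ alphaV G v := by
    rw [hl, ← Finset.card_powerset, ← Finset.card_image_of_injective _ compl_injective,
      ← Finset.card_image_of_injective (insert v L)ᶜ (hG.reachableAvoiding_injective v),
      ← Finset.card_union_of_disjoint hdisj]
    refine Finset.card_le_card fun t ht => ?_
    rw [Finset.mem_filter, subtreeFinset, Finset.mem_filter]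
    rcases Finset.mem_union.1 ht with ht | ht <;> obtain ⟨s, hs, rfl⟩ := Finset.mem_image.1 ht
    · have hsL := Finset.mem_powerset.1 hs
      exact ⟨⟨Finset.mem_univ _, hG.isSubtree_compl_of_leaves fun w hw => hLmem w (hsL hw)⟩,
        Finset.mem_compl.2 fun h => hvL (hsL h)⟩
    · have hsv : s ≠ v := fun h => Finset.mem_compl.1 hs (h ▸ Finset.mem_insert_self _ _)
      exact ⟨⟨Finset.mem_univ _, G.isSubtree_reachableAvoiding hsv⟩,
        G.root_mem_reachableAvoiding hsv⟩
  zify at hI hle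
  linarith
end
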